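/- For every ε > 0 there exists δ > 0 such that for all x, y ∈ ℍ, every continuous path γ : [0,1] → ℍ with γ(0) = x, γ(1) = y whose length (total variation) is at most dist(x,y) + δ satisfies: every point of the image γ([0,1]) lies within distance ε of the geodesic segment [x,y]. -/

import Mathlib

open Metric Set UpperHalfPlane

/-- The geodesic segment between two points of the hyperbolic plane, as the set of
points where the triangle inequality is an equality. -/
def geodSeg (x y : ℍ) : Set ℍ := {z : ℍ | dist x z + dist z y = dist x y}

theorem comb_aux (α β a b c u v w : ℝ) (hu : 0 < u) (hv : 0 < v) (hw : 0 < w)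
    (hpos : 0 < α * v + β * u)
    (h : α ^ 2 + β ^ 2 + 2 * α * β * (((a - b) ^ 2 + u ^ 2 + v ^ 2) / (2 * u * v)) = 1) :
    ((c - (α * a * v + β * b * u) / (α * v + β * u)) ^ 2 + w ^ 2
      + (u * v / (α * v + β * u)) ^ 2) / (2 * w * (u * v / (α * v + β * u)))
    = α * (((c - a) ^ 2 + w ^ 2 + u ^ 2) / (2 * w * u))
      + β * (((c - b) ^ 2 + w ^ 2 + v ^ 2) / (2 * w * v)) := by
  field_simp at h ⊢
  linear_combination (-u * v) * h

theorem exists_comb (x y : ℍ) (α β : ℝ) (hα : 0 ≤ α) (hβ : 0 ≤ β)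
    (h : α ^ 2 + β ^ 2 + 2 * α * β * Real.cosh (dist x y) = 1) :
    ∃ z : ℍ, ∀ p : ℍ, Real.cosh (dist p z)
      = α * Real.cosh (dist p x) + β * Real.cosh (dist p y) := by
  have hx := x.im_pos
  have hy := y.im_pos
  have hpos : 0 < α * y.im + β * x.im := by
    rcases hα.lt_or_eq with h1 | h1
    · have := mul_pos h1 hy
      positivity
    · rcases hβ.lt_or_eq with h2 | h2
      · have := mul_pos h2 hx
        positivity
      · rw [← h1, ← h2] at h
        norm_num at h
  have hv : 0 < x.im * y.im / (α * y.im + β * x.im) := by positivity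
  refine ⟨UpperHalfPlane.mk ⟨(α * x.re * y.im + β * y.re * x.im) / (α * y.im + β * x.im),
    x.im * y.im / (α * y.im + β * x.im)⟩ hv, fun p => ?_⟩
  have hp := p.im_pos
  rw [UpperHalfPlane.cosh_dist'] at h ⊢
  rw [UpperHalfPlane.cosh_dist', UpperHalfPlane.cosh_dist']
  exact comb_aux α β x.re y.re p.re x.im y.im p.im hx hy hp hpos h

theorem exists_point (x y p : ℍ) : ∃ z ∈ geodSeg x y,
    Real.cosh (dist p z) ≤ Real.exp ((dist x p + dist p y - dist x y) / 2) := by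
  rcases eq_or_ne x y with rfl | hne
  · refine ⟨x, by simp [geodSeg], ?_⟩
    have : (dist x p + dist p x - dist x x) / 2 = dist p x := by
      rw [dist_comm x p, dist_self]; ring
    rw [this, ← Real.cosh_add_sinh]
    linarith [Real.sinh_nonneg_iff.2 (dist_nonneg (x := p) (y := x))]
  have hD : 0 < dist x y := dist_pos.2 hne
  have hS : 0 < Real.sinh (dist x y) := Real.sinh_pos_iff.2 hD
  obtain ⟨s, hs⟩ : ∃ s, s = (dist x y + dist x p - dist p y) / 2 := ⟨_, rfl⟩
  obtain ⟨r, hr⟩ : ∃ r, r = (dist x y - dist x p + dist p y) / 2 := ⟨_, rfl⟩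
  obtain ⟨k, hk⟩ : ∃ k, k = (dist x p + dist p y - dist x y) / 2 := ⟨_, rfl⟩
  have hs0 : 0 ≤ s := by
    have := dist_triangle_left p y x
    linarith [dist_comm p y]
  have hr0 : 0 ≤ r := by
    have := dist_triangle x y p
    linarith [dist_comm p y]
  have hk0 : 0 ≤ k := by linarith [dist_triangle x p y]
  have hsr : dist x y = s + r := by linarith
  have ha : dist p x = s + k := by rw [dist_comm p x]; linarith
  have hb : dist p y = r + k := by linarith
  have hss := Real.sinh_nonneg_iff.2 hs0
  have hsr' := Real.sinh_nonneg_iff.2 hr0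
  have hsk := Real.sinh_nonneg_iff.2 hk0
  have qs := Real.cosh_sq s
  have qr := Real.cosh_sq r
  obtain ⟨z, hz⟩ := exists_comb x y (Real.sinh r / Real.sinh (dist x y))
    (Real.sinh s / Real.sinh (dist x y)) (by positivity) (by positivity) (by
      field_simp
      rw [hsr, Real.sinh_add, Real.cosh_add]
      linear_combination (-Real.sinh r ^ 2) * qs - (Real.sinh s ^ 2) * qr)
  have hx : dist x z = s := by
    have := hz x
    rw [dist_self, Real.cosh_zero] at this
    have h2 : Real.cosh (dist x z) = Real.cosh s := by
      rw [this]
      field_simp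
      rw [hsr, Real.sinh_add, Real.cosh_add]
      linear_combination (-Real.sinh r) * qs
    exact le_antisymm (by
      have := Real.cosh_le_cosh.1 h2.le
      rwa [abs_of_nonneg dist_nonneg, abs_of_nonneg hs0] at this) (by
      have := Real.cosh_le_cosh.1 h2.ge
      rwa [abs_of_nonneg dist_nonneg, abs_of_nonneg hs0] at this)
  have hy : dist y z = r := by
    have := hz y
    rw [dist_self, Real.cosh_zero, dist_comm y x] at this
    have h2 : Real.cosh (dist y z) = Real.cosh r := by
      rw [this]
      field_simp
      rw [hsr, Real.sinh_add, Real.cosh_add]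
      linear_combination (-Real.sinh s) * qr
    exact le_antisymm (by
      have := Real.cosh_le_cosh.1 h2.le
      rwa [abs_of_nonneg dist_nonneg, abs_of_nonneg hr0] at this) (by
      have := Real.cosh_le_cosh.1 h2.ge
      rwa [abs_of_nonneg dist_nonneg, abs_of_nonneg hr0] at this)
  refine ⟨z, ?_, ?_⟩
  · show dist x z + dist z y = dist x y
    rw [dist_comm z y, hx, hy, hsr]
  · rw [← hk, hz p, ha, hb, ← Real.cosh_add_sinh]
    have : Real.sinh r / Real.sinh (dist x y) * Real.cosh (s + k)
        + Real.sinh s / Real.sinh (dist x y) * Real.cosh (r + k)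
        = (Real.sinh r * Real.cosh (s + k) + Real.sinh s * Real.cosh (r + k))
          / Real.sinh (dist x y) := by ring
    rw [this, div_le_iff₀ hS, hsr, Real.sinh_add, Real.cosh_add, Real.cosh_add]
    have c1 := Real.sinh_lt_cosh s
    have c2 := Real.sinh_lt_cosh r
    have n1 := mul_nonneg (mul_nonneg hsk hss) (sub_nonneg.2 c2.le)
    have n2 := mul_nonneg (mul_nonneg hsk hsr') (sub_nonneg.2 c1.le)
    nlinarith

/-- **Paths almost realizing the distance stay close to the geodesic.**
For every `ε > 0` there is `δ > 0` such that for all `x y : ℍ`, every continuous path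
`γ : [0,1] → ℍ` from `x` to `y` whose length (total variation) is at most
`dist x y + δ` has its whole image within distance `ε` of the geodesic segment `[x,y]`. -/
theorem path_almost_geodesic_close_to_geodesic :
    ∀ ε > (0 : ℝ), ∃ δ > (0 : ℝ), ∀ x y : ℍ, ∀ γ : ℝ → ℍ,
      ContinuousOn γ (Icc 0 1) → γ 0 = x → γ 1 = y →
      eVariationOn γ (Icc 0 1) ≤ ENNReal.ofReal (dist x y + δ) →
      ∀ t ∈ Icc (0 : ℝ) 1, infDist (γ t) (geodSeg x y) ≤ ε := by
  intro ε hε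
  have hc : 1 < Real.cosh ε := Real.one_lt_cosh.2 hε.ne'
  refine ⟨2 * Real.log (Real.cosh ε), by have := Real.log_pos hc; positivity, ?_⟩
  intro x y γ _ h0 h1 hvar t ht
  obtain ⟨z, hz, hzp⟩ := exists_point x y (γ t)
  refine (infDist_le_dist_of_mem hz).trans ?_
  have hlen : dist x (γ t) + dist (γ t) y ≤ dist x y + 2 * Real.log (Real.cosh ε) := by
    have hl := Real.log_pos hc
    have i0 : (0 : ℝ) ∈ Icc (0 : ℝ) 1 := by simp
    have i1 : (1 : ℝ) ∈ Icc (0 : ℝ) 1 := by simp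
    have a1 := eVariationOn.edist_le γ (s := Icc 0 1 ∩ Icc 0 t) (x := 0) (y := t)
      ⟨i0, by simp [ht.1]⟩ ⟨ht, by simp [ht.1]⟩
    have a2 := eVariationOn.edist_le γ (s := Icc 0 1 ∩ Icc t 1) (x := t) (y := 1)
      ⟨ht, by simp [ht.2]⟩ ⟨i1, by simp [ht.2]⟩
    have a3 := eVariationOn.Icc_add_Icc γ ht.1 ht.2 ht
    have a4 := (add_le_add a1 a2).trans (a3.le.trans
      ((eVariationOn.mono γ inter_subset_left).trans hvar))
    rw [h0, h1, edist_dist, edist_dist, ← ENNReal.ofReal_add dist_nonneg dist_nonneg,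
      ENNReal.ofReal_le_ofReal_iff (by positivity)] at a4
    exact a4
  have h2 : Real.cosh (dist (γ t) z) ≤ Real.cosh ε := by
    refine hzp.trans ?_
    rw [← Real.le_log_iff_exp_le (by positivity)]
    linarith
  rw [Real.cosh_le_cosh, abs_of_nonneg dist_nonneg, abs_of_pos hε] at h2
  exact h2
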